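/- Let (E, F) be a resistance form on a set X whose resistance metric R is complete and such that (X,R) is doubling and uniformly perfect. Write supp(u) := cl({x ∈ X : u(x) ≠ 0}) (closure in (X,R)). Then the following are equivalent: (i) E(u,v) = 0 whenever u, v ∈ F satisfy supp(u) ∩ supp(v) = ∅; (ii) E(u,v) = 0 whenever u, v ∈ F satisfy inf{R(x,y) : u(x) ≠ 0, v(y) ≠ 0} > 0; (iii) E(u,v) = 0 whenever u, v ∈ F have disjoint compact supports. -/

import Mathlib

open Filter Set Metric
open scoped ENNReal Topology

/-- A resistance form `(E, F)` on a set `X` (Kigami):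
`F` is a linear subspace of the real-valued functions on `X`, `E` is a nonnegative
symmetric bilinear form on `F` such that (RF1) constants belong to `F` and
`E(u,u) = 0` iff `u` is constant, (RF2) the quotient of `F` by the constants is a
Hilbert space under `E` (stated as completeness of the `E`-seminorm on `F`),
(RF3) points of `X` are separated by `F`, (RF4) for `x ≠ y` the quantity
`R(x,y) = (inf {E(u,u) : u ∈ F, u x = 1, u y = 0})⁻¹` is finite (i.e. the infimum
is positive; an admissible `u` always exists), and (RF5) the Markov property holds
for the unit truncation. -/
structure ResistanceForm (X : Type*) where
  F : Set (X → ℝ)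
  E : (X → ℝ) → (X → ℝ) → ℝ
  zero_mem : (0 : X → ℝ) ∈ F
  add_mem : ∀ {u v : X → ℝ}, u ∈ F → v ∈ F → u + v ∈ F
  smul_mem : ∀ (c : ℝ) {u : X → ℝ}, u ∈ F → c • u ∈ F
  const_mem : ∀ c : ℝ, (fun _ => c) ∈ F
  symm : ∀ u ∈ F, ∀ v ∈ F, E u v = E v u
  add_left : ∀ u ∈ F, ∀ v ∈ F, ∀ w ∈ F, E (u + v) w = E u w + E v w
  smul_left : ∀ (c : ℝ), ∀ u ∈ F, ∀ v ∈ F, E (c • u) v = c * E u v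
  nonneg : ∀ u ∈ F, 0 ≤ E u u
  null_iff_const : ∀ u ∈ F, (E u u = 0 ↔ ∃ c : ℝ, ∀ x, u x = c)
  complete : ∀ u : ℕ → (X → ℝ), (∀ n, u n ∈ F) →
    (∀ ε : ℝ, 0 < ε → ∃ N : ℕ, ∀ m ≥ N, ∀ n ≥ N, E (u m - u n) (u m - u n) < ε) →
    ∃ v ∈ F, ∀ ε : ℝ, 0 < ε → ∃ N : ℕ, ∀ n ≥ N, E (v - u n) (v - u n) < ε
  sep : ∀ x y : X, x ≠ y → ∃ u ∈ F, u x ≠ u y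
  exists_unit : ∀ x y : X, x ≠ y → ∃ u ∈ F, u x = 1 ∧ u y = 0
  inf_pos : ∀ x y : X, x ≠ y →
    0 < sInf {e : ℝ | ∃ u ∈ F, u x = 1 ∧ u y = 0 ∧ E u u = e}
  markov : ∀ u ∈ F, (fun x => max 0 (min 1 (u x))) ∈ F ∧
    E (fun x => max 0 (min 1 (u x))) (fun x => max 0 (min 1 (u x))) ≤ E u u

namespace ResistanceForm

variable {X : Type*}

open Classical in
/-- The resistance metric `R` associated with a resistance form:
`R(x,x) = 0` and `R(x,y) = (inf {E(u,u) : u ∈ F, u x = 1, u y = 0})⁻¹` for `x ≠ y`. -/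
noncomputable def rmetric (rf : ResistanceForm X) (x y : X) : ℝ :=
  if x = y then 0
  else (sInf {e : ℝ | ∃ u ∈ rf.F, u x = 1 ∧ u y = 0 ∧ rf.E u u = e})⁻¹

open Classical in
/-- The resistance `𝓡(A,B)` between two sets: the reciprocal of the minimal energy of
functions that are `≡ 1` on `A` and `≡ 0` on `B` if such functions exist, `0` if no
such function exists, and `∞` if `A` or `B` is empty. -/
noncomputable def setRes (rf : ResistanceForm X) (A B : Set X) : ℝ≥0∞ :=
  if A.Nonempty ∧ B.Nonempty then
    (if ∃ u ∈ rf.F, (∀ x ∈ A, u x = 1) ∧ (∀ x ∈ B, u x = 0) then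
      (ENNReal.ofReal
        (sInf {e : ℝ | ∃ u ∈ rf.F, (∀ x ∈ A, u x = 1) ∧ (∀ x ∈ B, u x = 0) ∧ rf.E u u = e}))⁻¹
    else 0)
  else ⊤

end ResistanceForm

/-- A distance function `ρ` on `X` is doubling: there is `N ∈ ℕ` such that every ball of
radius `2r` is covered by `N` balls of radius `r`. -/
def DoublingOf {X : Type*} (ρ : X → X → ℝ) : Prop :=
  ∃ N : ℕ, ∀ (x : X) (r : ℝ), ∃ s : Finset X, s.card ≤ N ∧
    {y : X | ρ x y < 2 * r} ⊆ ⋃ z ∈ s, {y : X | ρ z y < r}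

/-- A distance function `ρ` on `X` is uniformly perfect: there is `γ > 1` such that
`B(x, γ r) \ B(x, r) ≠ ∅` whenever `B(x,r)` is not the whole space. -/
def UniformlyPerfectOf {X : Type*} (ρ : X → X → ℝ) : Prop :=
  ∃ γ : ℝ, 1 < γ ∧ ∀ (x : X) (r : ℝ), 0 < r → {y : X | ρ x y < r} ≠ Set.univ →
    ({y : X | ρ x y < γ * r} \ {y : X | ρ x y < r}).Nonempty

namespace ResistanceForm

section Aux

variable {X : Type*} (rf : ResistanceForm X)

lemma sub_mem' {u v : X → ℝ} (hu : u ∈ rf.F) (hv : v ∈ rf.F) : u - v ∈ rf.F := by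
  have := rf.add_mem hu (rf.smul_mem (-1) hv)
  convert this using 1
  ext x; simp [sub_eq_add_neg]

lemma add_right' {u v w : X → ℝ} (hu : u ∈ rf.F) (hv : v ∈ rf.F) (hw : w ∈ rf.F) :
    rf.E u (v + w) = rf.E u v + rf.E u w := by
  rw [rf.symm u hu _ (rf.add_mem hv hw), rf.add_left v hv w hw u hu, rf.symm v hv u hu,
    rf.symm w hw u hu]

lemma smul_right' (c : ℝ) {u v : X → ℝ} (hu : u ∈ rf.F) (hv : v ∈ rf.F) :
    rf.E u (c • v) = c * rf.E u v := by
  rw [rf.symm u hu _ (rf.smul_mem c hv), rf.smul_left c v hv u hu, rf.symm v hv u hu]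

lemma E_add_smul (t : ℝ) {u v : X → ℝ} (hu : u ∈ rf.F) (hv : v ∈ rf.F) :
    rf.E (u + t • v) (u + t • v) = rf.E u u + 2 * t * rf.E u v + t ^ 2 * rf.E v v := by
  have h := rf.smul_mem t hv
  rw [rf.add_left u hu _ h _ (rf.add_mem hu h), rf.add_right' hu hu h, rf.add_right' h hu h,
    rf.smul_right' t hu hv, rf.smul_left t v hv u hu, rf.smul_left t v hv _ h,
    rf.smul_right' t hv hv, rf.symm v hv u hu]
  ring

lemma E_add_le {u v : X → ℝ} (hu : u ∈ rf.F) (hv : v ∈ rf.F) (t : ℝ) :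
    rf.E (u + t • v) (u + t • v) ≤ 2 * rf.E u u + 2 * t ^ 2 * rf.E v v := by
  have h1 := rf.E_add_smul t hu hv
  have h2 := rf.E_add_smul (-t) hu hv
  have h3 := rf.nonneg _ (rf.add_mem hu (rf.smul_mem (-t) hv))
  nlinarith

lemma E_const_right {u : X → ℝ} (hu : u ∈ rf.F) (c : ℝ) : rf.E u (fun _ => c) = 0 := by
  have h0 : rf.E (fun _ => c) (fun _ => c) = 0 :=
    (rf.null_iff_const _ (rf.const_mem c)).2 ⟨c, fun _ => rfl⟩
  by_contra hne
  set b := rf.E u (fun _ => c) with hb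
  have h := rf.E_add_smul (-(rf.E u u + 1) / (2 * b)) hu (rf.const_mem c)
  have h3 := rf.nonneg _ (rf.add_mem hu (rf.smul_mem (-(rf.E u u + 1) / (2 * b))
    (rf.const_mem c)))
  rw [h, h0, ← hb] at h3
  have : 2 * (-(rf.E u u + 1) / (2 * b)) * b = -(rf.E u u + 1) := by field_simp
  rw [this] at h3
  linarith

lemma E_const_left {u : X → ℝ} (hu : u ∈ rf.F) (c : ℝ) : rf.E (fun _ => c) u = 0 := by
  rw [rf.symm _ (rf.const_mem c) u hu, rf.E_const_right hu]

lemma E_sub_const {u v : X → ℝ} (hu : u ∈ rf.F) (hv : v ∈ rf.F) (c d : ℝ) :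
    rf.E (u - fun _ => c) (v - fun _ => d) = rf.E u v := by
  have e : ∀ (u : X → ℝ) (c : ℝ), (u - fun _ => c) = u + fun _ => -c := by
    intro u c; ext x; simp [sub_eq_add_neg]
  rw [e, e, rf.add_left u hu _ (rf.const_mem _) _ (rf.add_mem hv (rf.const_mem _)),
    rf.E_const_left (rf.add_mem hv (rf.const_mem _)), rf.add_right' hu hv (rf.const_mem _),
    rf.E_const_right hu]
  ring

/-- truncation to `[0,n]` -/
lemma trunc {n : ℝ} (hn : 0 < n) {u : X → ℝ} (hu : u ∈ rf.F) :
    (fun x => max 0 (min n (u x))) ∈ rf.F ∧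
      rf.E (fun x => max 0 (min n (u x))) (fun x => max 0 (min n (u x))) ≤ rf.E u u := by
  have h1 := rf.smul_mem n⁻¹ hu
  obtain ⟨h2, h3⟩ := rf.markov _ h1
  have e : (fun x => max 0 (min n (u x))) = n • (fun x => max 0 (min 1 ((n⁻¹ • u) x))) := by
    ext x
    simp only [Pi.smul_apply, smul_eq_mul]
    rw [mul_max_of_nonneg _ _ hn.le, mul_min_of_nonneg _ _ hn.le, mul_inv_cancel_left₀ hn.ne']
    simp
  rw [e]
  refine ⟨rf.smul_mem n h2, ?_⟩
  rw [rf.smul_left n _ h2 _ (rf.smul_mem n h2), rf.smul_right' n h2 h2]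
  rw [rf.smul_left _ _ hu _ h1, rf.smul_right' _ hu hu] at h3
  calc _ ≤ n * (n * (n⁻¹ * (n⁻¹ * rf.E u u))) := by gcongr
    _ = rf.E u u := by field_simp

/-- The subspace of functions in `F` vanishing at `x0`. -/
def F0 (x0 : X) : Submodule ℝ (X → ℝ) where
  carrier := {f | f ∈ rf.F ∧ f x0 = 0}
  add_mem' := fun ha hb => ⟨rf.add_mem ha.1 hb.1, by simp [ha.2, hb.2]⟩
  zero_mem' := ⟨rf.zero_mem, rfl⟩
  smul_mem' := fun c _ ha => ⟨rf.smul_mem c ha.1, by simp [ha.2]⟩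

/-- Hilbert space of functions in `F` vanishing at `x0`. -/
def HF (x0 : X) : Type _ := ↥(rf.F0 x0)

instance (x0 : X) : AddCommGroup (rf.HF x0) := inferInstanceAs (AddCommGroup ↥(rf.F0 x0))
instance (x0 : X) : Module ℝ (rf.HF x0) := inferInstanceAs (Module ℝ ↥(rf.F0 x0))

/-- evaluation -/
def ev (x0 x : X) : rf.HF x0 →ₗ[ℝ] ℝ := (LinearMap.proj x).comp (rf.F0 x0).subtype

/-- underlying function -/
def toFn (x0 : X) : rf.HF x0 →ₗ[ℝ] (X → ℝ) := (rf.F0 x0).subtype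

lemma ev_eq (x0 x : X) (f : rf.HF x0) : rf.ev x0 x f = rf.toFn x0 f x := rfl

lemma toFn_mem (x0 : X) (f : rf.HF x0) : rf.toFn x0 f ∈ rf.F := f.2.1

lemma toFn_base (x0 : X) (f : rf.HF x0) : rf.toFn x0 f x0 = 0 := f.2.2

lemma toFn_inj (x0 : X) {f g : rf.HF x0} (h : rf.toFn x0 f = rf.toFn x0 g) : f = g :=
  Subtype.ext h

/-- constructor -/
def mkH (x0 : X) (f : X → ℝ) (hf : f ∈ rf.F) (h0 : f x0 = 0) : rf.HF x0 := ⟨f, hf, h0⟩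

lemma toFn_mkH (x0 : X) (f : X → ℝ) (hf : f ∈ rf.F) (h0 : f x0 = 0) :
    rf.toFn x0 (rf.mkH x0 f hf h0) = f := rfl

/-- core -/
noncomputable def core (x0 : X) : InnerProductSpace.Core ℝ (rf.HF x0) where
  inner f g := rf.E (rf.toFn x0 f) (rf.toFn x0 g)
  conj_inner_symm f g := by
    simpa using rf.symm _ (rf.toFn_mem x0 g) _ (rf.toFn_mem x0 f)
  re_inner_nonneg f := by simpa using rf.nonneg _ (rf.toFn_mem x0 f)
  add_left f g h := by
    simp only [map_add]
    exact rf.add_left _ (rf.toFn_mem x0 f) _ (rf.toFn_mem x0 g) _ (rf.toFn_mem x0 h)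
  smul_left f g c := by
    simp only [map_smul]
    simpa using rf.smul_left c _ (rf.toFn_mem x0 f) _ (rf.toFn_mem x0 g)
  definite f hf := by
    obtain ⟨c, hc⟩ := (rf.null_iff_const _ (rf.toFn_mem x0 f)).1 hf
    have := rf.toFn_base x0 f
    apply rf.toFn_inj x0
    ext x
    rw [hc x, ← hc x0, this]
    simp

noncomputable instance (x0 : X) : NormedAddCommGroup (rf.HF x0) :=
  (rf.core x0).toNormedAddCommGroup

noncomputable instance (x0 : X) : InnerProductSpace ℝ (rf.HF x0) :=
  InnerProductSpace.ofCore (rf.core x0).toCore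

lemma inner_eq (x0 : X) (f g : rf.HF x0) :
    inner ℝ f g = rf.E (rf.toFn x0 f) (rf.toFn x0 g) := rfl

lemma norm_sq_eq (x0 : X) (f : rf.HF x0) :
    ‖f‖ ^ 2 = rf.E (rf.toFn x0 f) (rf.toFn x0 f) := by
  rw [← real_inner_self_eq_norm_sq, inner_eq]

instance (x0 : X) : CompleteSpace (rf.HF x0) := by
  apply Metric.complete_of_cauchySeq_tendsto
  intro u hu
  obtain ⟨v, hv, hlim⟩ := rf.complete (fun n => rf.toFn x0 (u n)) (fun n => rf.toFn_mem x0 _) (by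
    intro ε hε
    obtain ⟨N, hN⟩ := Metric.cauchySeq_iff.1 hu (√ε) (Real.sqrt_pos.2 hε)
    refine ⟨N, fun m hm n hn => ?_⟩
    have := hN m hm n hn
    rw [dist_eq_norm] at this
    rw [← map_sub, ← norm_sq_eq]
    exact (Real.lt_sqrt (norm_nonneg _)).1 this)
  have hc := rf.const_mem (v x0)
  refine ⟨rf.mkH x0 (v - fun _ => v x0) (rf.sub_mem' hv hc) (by simp), ?_⟩
  rw [Metric.tendsto_atTop]
  intro ε hε
  obtain ⟨N, hN⟩ := hlim (ε ^ 2) (by positivity)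
  refine ⟨N, fun n hn => ?_⟩
  have := hN n hn
  rw [dist_comm, dist_eq_norm]
  refine lt_of_pow_lt_pow_left₀ 2 hε.le ?_
  rw [norm_sq_eq, map_sub, toFn_mkH]
  have e : (v - fun _ => v x0) - rf.toFn x0 (u n) = (v - rf.toFn x0 (u n)) - fun _ => v x0 := by
    ext x; simp; ring
  have hd := rf.sub_mem' hv (rf.toFn_mem x0 (u n))
  rw [e, rf.E_sub_const hd hd]
  exact this

end Aux

section Met

variable {X : Type*} [MetricSpace X] (rf : ResistanceForm X)

lemma sq_le (hR : ∀ x y : X, dist x y = rf.rmetric x y) {f : X → ℝ} (hf : f ∈ rf.F) (x y : X) :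
    (f x - f y) ^ 2 ≤ rf.E f f * dist x y := by
  by_cases hxy : x = y
  · subst hxy; simp
  by_cases ha : f x - f y = 0
  · rw [ha]
    have := mul_nonneg (rf.nonneg f hf) (dist_nonneg (x := x) (y := y))
    simpa using this
  set a := f x - f y with haa
  have hg := rf.sub_mem' hf (rf.const_mem (f y))
  have hd : dist x y = (sInf {e : ℝ | ∃ u ∈ rf.F, u x = 1 ∧ u y = 0 ∧ rf.E u u = e})⁻¹ := by
    rw [hR, rmetric, if_neg hxy]
  have hp := rf.inf_pos x y hxy
  have hle : sInf {e : ℝ | ∃ u ∈ rf.F, u x = 1 ∧ u y = 0 ∧ rf.E u u = e}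
      ≤ a⁻¹ * (a⁻¹ * rf.E f f) := by
    apply csInf_le
    · refine ⟨0, ?_⟩
      rintro _ ⟨u, hu, _, _, rfl⟩
      exact rf.nonneg u hu
    · refine ⟨a⁻¹ • (f - fun _ => f y), rf.smul_mem _ hg, ?_, by simp, ?_⟩
      · simp [← haa, ha]
      · rw [rf.smul_left _ _ hg _ (rf.smul_mem _ hg), rf.smul_right' _ hg hg, rf.E_sub_const hf hf]
  rw [hd]
  generalize sInf {e : ℝ | ∃ u ∈ rf.F, u x = 1 ∧ u y = 0 ∧ rf.E u u = e} = s at *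
  rw [← div_eq_mul_inv, le_div_iff₀ hp]
  calc a ^ 2 * s ≤ a ^ 2 * (a⁻¹ * (a⁻¹ * rf.E f f)) := by gcongr
    _ = rf.E f f := by field_simp

/-- A good bump function. -/
lemma exists_bump (hR : ∀ x y : X, dist x y = rf.rmetric x y) (x y : X) (hxy : x ≠ y) :
    ∃ u ∈ rf.F, u x = 1 ∧ u y = 0 ∧ (∀ z, 0 ≤ u z) ∧ rf.E u u * dist x y ≤ 2 := by
  have hd : dist x y = (sInf {e : ℝ | ∃ u ∈ rf.F, u x = 1 ∧ u y = 0 ∧ rf.E u u = e})⁻¹ := by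
    rw [hR, rmetric, if_neg hxy]
  have hp := rf.inf_pos x y hxy
  obtain ⟨w, hw, hw1, hw0⟩ := rf.exists_unit x y hxy
  obtain ⟨_, ⟨u, hu, h1, h0, rfl⟩, hlt⟩ := exists_lt_of_csInf_lt
    (s := {e : ℝ | ∃ u ∈ rf.F, u x = 1 ∧ u y = 0 ∧ rf.E u u = e}) ⟨_, w, hw, hw1, hw0, rfl⟩
    (lt_mul_of_one_lt_left hp (one_lt_two))
  obtain ⟨h2, h3⟩ := rf.markov u hu
  refine ⟨_, h2, by simp [h1], by simp [h0], fun z => le_max_left _ _, ?_⟩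
  rw [hd]
  generalize sInf {e : ℝ | ∃ u ∈ rf.F, u x = 1 ∧ u y = 0 ∧ rf.E u u = e} = s at *
  rw [← div_eq_mul_inv, div_le_iff₀ hp]
  linarith

lemma abs_ev_le (hR : ∀ x y : X, dist x y = rf.rmetric x y) (x0 x : X) (f : rf.HF x0) :
    ‖rf.ev x0 x f‖ ≤ √(dist x x0) * ‖f‖ := by
  have h := rf.sq_le hR (rf.toFn_mem x0 f) x x0
  rw [toFn_base, sub_zero, ← norm_sq_eq] at h
  rw [ev_eq, Real.norm_eq_abs]
  apply abs_le_of_sq_le_sq _ (by positivity)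
  rw [mul_pow, Real.sq_sqrt dist_nonneg]
  linarith

/-- continuous evaluation -/
noncomputable def evL (hR : ∀ x y : X, dist x y = rf.rmetric x y) (x0 x : X) :
    rf.HF x0 →L[ℝ] ℝ :=
  (rf.ev x0 x).mkContinuous (√(dist x x0)) (rf.abs_ev_le hR x0 x)

lemma evL_eq (hR : ∀ x y : X, dist x y = rf.rmetric x y) (x0 x : X) (f : rf.HF x0) :
    rf.evL hR x0 x f = rf.toFn x0 f x := rfl

lemma weakH (hR : ∀ x y : X, dist x y = rf.rmetric x y) (x0 : X) (d : ℕ → rf.HF x0) (C : ℝ)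
    (hC : ∀ n, ‖d n‖ ≤ C) (hd : ∀ x, Tendsto (fun n => rf.toFn x0 (d n) x) atTop (𝓝 0))
    (v : rf.HF x0) : Tendsto (fun n => inner ℝ (d n) v) atTop (𝓝 0) := by
  let V : Submodule ℝ (rf.HF x0) :=
    { carrier := {v | Tendsto (fun n => inner ℝ (d n) v) atTop (𝓝 0)}
      add_mem' := by
        intro a b ha hb
        simp only [Set.mem_ofPred_eq, inner_add_right]
        simpa using Tendsto.add ha hb
      zero_mem' := by simp
      smul_mem' := by
        intro c a ha
        simp only [Set.mem_ofPred_eq, inner_smul_right]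
        simpa using Tendsto.const_mul c ha }
  have hC0 : 0 ≤ C := (norm_nonneg _).trans (hC 0)
  have hcl : IsClosed (V : Set (rf.HF x0)) := by
    rw [← closure_subset_iff_isClosed]
    intro a ha
    change Tendsto (fun n => inner ℝ (d n) a) atTop (𝓝 0)
    rw [Metric.tendsto_atTop]
    intro ε hε
    obtain ⟨b, hb, hab⟩ := Metric.mem_closure_iff.1 ha (ε / (2 * (C + 1))) (by positivity)
    obtain ⟨N, hN⟩ := (Metric.tendsto_atTop.1 (show Tendsto (fun n => inner ℝ (d n) b) atTop (𝓝 0)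
      from hb)) (ε / 2) (by positivity)
    refine ⟨N, fun n hn => ?_⟩
    have h1 := hN n hn
    rw [dist_eq_norm, sub_zero] at h1 ⊢
    have h2 : inner ℝ (d n) a = inner ℝ (d n) b + inner ℝ (d n) (a - b) := by
      rw [← inner_add_right]; simp
    have h3 : ‖inner ℝ (d n) (a - b)‖ ≤ ‖d n‖ * ‖a - b‖ := norm_inner_le_norm _ _
    rw [dist_eq_norm] at hab
    have h4 : ‖d n‖ * ‖a - b‖ ≤ C * (ε / (2 * (C + 1))) := by
      gcongr
      exact hC n
    have h5 : C * (ε / (2 * (C + 1))) ≤ ε / 2 := by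
      rw [mul_div_assoc', div_le_div_iff₀ (by positivity) (by positivity)]
      nlinarith
    rw [h2]
    have h6 := norm_add_le (inner ℝ (d n) b) (inner ℝ (d n) (a - b))
    linarith
  have hVc : IsComplete (V : Set (rf.HF x0)) := hcl.isComplete
  have : CompleteSpace V := hVc.completeSpace_coe
  have horth : Vᗮ = ⊥ := by
    rw [Submodule.eq_bot_iff]
    intro w hw
    apply rf.toFn_inj x0
    ext x
    have hk : (InnerProductSpace.toDual ℝ (rf.HF x0)).symm (rf.evL hR x0 x) ∈ V := by
      change Tendsto (fun n => inner ℝ (d n)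
        ((InnerProductSpace.toDual ℝ (rf.HF x0)).symm (rf.evL hR x0 x))) atTop (𝓝 0)
      refine (hd x).congr fun n => ?_
      rw [real_inner_comm, InnerProductSpace.toDual_symm_apply, evL_eq]
    have := (Submodule.mem_orthogonal V w).1 hw _ hk
    rw [InnerProductSpace.toDual_symm_apply, evL_eq] at this
    simpa using this
  have hV : V = ⊤ := Submodule.orthogonal_eq_bot_iff.1 horth
  have : v ∈ V := by rw [hV]; trivial
  exact this

lemma weak (hR : ∀ x y : X, dist x y = rf.rmetric x y) (x0 : X) (p : ℕ → X → ℝ)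
    (hp : ∀ n, p n ∈ rf.F) (C : ℝ) (hC : ∀ n, rf.E (p n) (p n) ≤ C) {u v : X → ℝ}
    (hu : u ∈ rf.F) (hv : v ∈ rf.F) (hlim : ∀ x, Tendsto (fun n => p n x) atTop (𝓝 (u x))) :
    Tendsto (fun n => rf.E (p n) v) atTop (𝓝 (rf.E u v)) := by
  have hdm : ∀ n, p n + (-1 : ℝ) • u ∈ rf.F := fun n => rf.add_mem (hp n) (rf.smul_mem _ hu)
  let d : ℕ → rf.HF x0 := fun n => rf.mkH x0
    ((p n + (-1 : ℝ) • u) - fun _ => (p n + (-1 : ℝ) • u) x0)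
    (rf.sub_mem' (hdm n) (rf.const_mem _)) (by simp)
  let v' : rf.HF x0 := rf.mkH x0 (v - fun _ => v x0) (rf.sub_mem' hv (rf.const_mem _)) (by simp)
  have hptw : ∀ x, Tendsto (fun n => (p n + (-1 : ℝ) • u) x) atTop (𝓝 0) := by
    intro x
    have := (hlim x).sub_const (u x)
    simpa [sub_eq_add_neg] using this
  have key := rf.weakH hR x0 d (√(2 * C + 2 * rf.E u u)) (by
    intro n
    apply Real.le_sqrt_of_sq_le
    rw [norm_sq_eq, toFn_mkH, rf.E_sub_const (hdm n) (hdm n)]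
    have := rf.E_add_le (hp n) hu (-1)
    have := hC n
    linarith) (by
    intro x
    have := (hptw x).sub (hptw x0)
    simpa [d, toFn_mkH] using this) v'
  have e : ∀ n, inner ℝ (d n) v' = rf.E (p n) v - rf.E u v := by
    intro n
    rw [inner_eq, toFn_mkH, toFn_mkH, rf.E_sub_const (hdm n) hv,
      rf.add_left _ (hp n) _ (rf.smul_mem _ hu) _ hv, rf.smul_left _ _ hu _ hv]
    ring
  simp only [e] at key
  simpa using key.add_const (rf.E u v)

end Met

end ResistanceForm

lemma doubling_iter {X : Type*} [MetricSpace X] (hdb : DoublingOf fun x y : X => dist x y)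
    (m : ℕ) : ∃ M : ℕ, ∀ (x : X) (r : ℝ), ∃ s : Finset X, s.card ≤ M ∧
      ∀ y, dist x y < 2 ^ m * r → ∃ z ∈ s, dist z y < r := by
  classical
  obtain ⟨N, hN⟩ := hdb
  induction m with
  | zero => exact ⟨1, fun x r => ⟨{x}, by simp, fun y hy => ⟨x, by simp, by simpa using hy⟩⟩⟩
  | succ m ih =>
    obtain ⟨M, hM⟩ := ih
    refine ⟨M * N, fun x r => ?_⟩
    obtain ⟨s, hs, hs'⟩ := hM x (2 * r)
    choose t ht ht' using fun z => hN z r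
    refine ⟨s.biUnion t, ?_, ?_⟩
    · exact (Finset.card_biUnion_le_card_mul s t N fun z _ => ht z).trans
        (Nat.mul_le_mul_right _ hs)
    · intro y hy
      obtain ⟨z, hz, hzy⟩ := hs' y (by rw [pow_succ] at hy; linarith)
      have := ht' z (show y ∈ {y | dist z y < 2 * r} from hzy)
      simp only [mem_iUnion, mem_ofPred_eq, exists_prop] at this
      obtain ⟨w, hw, hwy⟩ := this
      exact ⟨w, Finset.mem_biUnion.2 ⟨z, hz, hw⟩, hwy⟩

lemma compact_of_bdd {X : Type*} [MetricSpace X] [CompleteSpace X]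
    (hdb : DoublingOf fun x y : X => dist x y) {K : Set X} (hK : IsClosed K) (x0 : X) (ρ : ℝ)
    (hb : ∀ y ∈ K, dist x0 y < ρ) : IsCompact K := by
  refine TotallyBounded.isCompact_of_isClosed ?_ hK
  rw [Metric.totallyBounded_iff]
  intro ε hε
  obtain ⟨m, hm⟩ := pow_unbounded_of_one_lt (ρ / ε) (one_lt_two)
  obtain ⟨M, hM⟩ := doubling_iter hdb m
  obtain ⟨s, -, hs⟩ := hM x0 ε
  refine ⟨s, s.finite_toSet, fun y hy => ?_⟩
  obtain ⟨z, hz, hzy⟩ := hs y ((hb y hy).trans ((div_lt_iff₀ hε).1 hm))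
  simp only [mem_iUnion, Metric.mem_ball]
  exact ⟨z, hz, by rwa [dist_comm]⟩

namespace ResistanceForm

variable {X : Type*} [MetricSpace X] (rf : ResistanceForm X)

lemma shell (hR : ∀ x y : X, dist x y = rf.rmetric x y)
    (hdb : DoublingOf fun x y : X => dist x y) (x0 : X) :
    ∃ C : ℝ, ∀ t : ℝ, 0 < t → ∃ G : rf.HF x0, (∀ y, 0 ≤ rf.toFn x0 G y) ∧ ‖G‖ ≤ C / t ∧
      ∀ y, t ^ 2 ≤ dist x0 y → dist x0 y < 16 * t ^ 2 → 1 / 2 ≤ rf.toFn x0 G y := by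
  classical
  obtain ⟨M, hM⟩ := doubling_iter hdb 8
  refine ⟨M * 2, fun t ht => ?_⟩
  obtain ⟨s, hs, hcov⟩ := hM x0 (t ^ 2 / 16)
  have hb : ∀ z : X, ∃ h : rf.HF x0, (∀ y, 0 ≤ rf.toFn x0 h y) ∧ ‖h‖ ≤ 2 / t ∧
      (15 / 16 * t ^ 2 ≤ dist x0 z → ∀ y, dist z y < t ^ 2 / 16 → 1 / 2 ≤ rf.toFn x0 h y) := by
    intro z
    by_cases hz : 15 / 16 * t ^ 2 ≤ dist x0 z
    · have hne : z ≠ x0 := by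
        rintro rfl
        rw [dist_self] at hz
        have : 0 < t ^ 2 := by positivity
        linarith
      obtain ⟨u, hu, h1, h0, hnn, hE⟩ := rf.exists_bump hR z x0 hne
      have hEn := rf.nonneg u hu
      have hE' : rf.E u u * t ^ 2 ≤ 3 := by
        rw [dist_comm] at hE
        nlinarith [mul_le_mul_of_nonneg_left hz hEn]
      refine ⟨rf.mkH x0 u hu h0, hnn, ?_, fun _ y hy => ?_⟩
      · refine le_of_sq_le_sq ?_ (by positivity)
        rw [norm_sq_eq, toFn_mkH, div_pow, le_div_iff₀ (by positivity)]
        linarith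
      · rw [toFn_mkH]
        have h := rf.sq_le hR hu z y
        rw [h1] at h
        have h2 : rf.E u u * dist z y ≤ 3 / 16 := by
          have := mul_le_mul_of_nonneg_left hy.le hEn
          linarith
        nlinarith
    · exact ⟨0, by simp, by simp; positivity, fun h => absurd h hz⟩
  choose h hnn hnorm hlow using hb
  refine ⟨∑ z ∈ s, h z, ?_, ?_, ?_⟩
  · intro y
    rw [map_sum, Finset.sum_apply]
    exact Finset.sum_nonneg fun z _ => hnn z y
  · calc ‖∑ z ∈ s, h z‖ ≤ ∑ z ∈ s, ‖h z‖ := norm_sum_le _ _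
      _ ≤ ∑ z ∈ s, 2 / t := Finset.sum_le_sum fun z _ => hnorm z
      _ = s.card * (2 / t) := by simp
      _ ≤ M * (2 / t) := by gcongr
      _ = M * 2 / t := by ring
  · intro y hy1 hy2
    obtain ⟨z, hz, hzy⟩ := hcov y (by norm_num; linarith)
    rw [map_sum, Finset.sum_apply]
    refine (hlow z ?_ y hzy).trans
      (Finset.single_le_sum (f := fun z => rf.toFn x0 (h z) y) (fun z _ => hnn z y) hz)
    have := dist_triangle x0 z y
    linarith

/-- A nonnegative function in `F` with bounded sublevel sets. -/
lemma exists_exhaustion (hR : ∀ x y : X, dist x y = rf.rmetric x y)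
    (hdb : DoublingOf fun x y : X => dist x y) (x0 : X) :
    ∃ H ∈ rf.F, (∀ y, 0 ≤ H y) ∧ ∀ c : ℝ, ∃ ρ : ℝ, ∀ y, H y ≤ c → dist x0 y < ρ := by
  obtain ⟨C, hC⟩ := rf.shell hR hdb x0
  choose G hnn hnorm hlow using fun k : ℕ => hC (4 ^ k) (by positivity)
  have hsum : Summable fun k : ℕ => (2 : ℝ) ^ k • G k := by
    apply Summable.of_norm_bounded (g := fun k : ℕ => C * (1 / 2 : ℝ) ^ k)
    · exact summable_geometric_two.mul_left C
    · intro k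
      rw [norm_smul, norm_pow, Real.norm_two]
      calc (2 : ℝ) ^ k * ‖G k‖ ≤ 2 ^ k * (C / 4 ^ k) := by gcongr; exact hnorm k
        _ = C * (1 / 2) ^ k := by
          rw [show (4 : ℝ) = 2 * 2 by norm_num, mul_pow, div_pow, one_pow]
          field_simp
  have hev : ∀ y, HasSum (fun k : ℕ => (2 : ℝ) ^ k * rf.toFn x0 (G k) y)
      (rf.toFn x0 (∑' k : ℕ, (2 : ℝ) ^ k • G k) y) := by
    intro y
    have := (rf.evL hR x0 y).hasSum hsum.hasSum
    simpa [evL_eq] using this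
  have hnn' : ∀ y (k : ℕ), 0 ≤ (2 : ℝ) ^ k * rf.toFn x0 (G k) y := fun y k =>
    mul_nonneg (by positivity) (hnn k y)
  refine ⟨_, rf.toFn_mem x0 (∑' k : ℕ, (2 : ℝ) ^ k • G k), fun y => (hev y).nonneg (hnn' y), ?_⟩
  intro c
  obtain ⟨n, hn⟩ := exists_nat_gt (2 * c)
  refine ⟨16 ^ (n + 1), fun y hy => ?_⟩
  rcases lt_or_ge (dist x0 y) 1 with h1 | h1
  · exact h1.trans_le (one_le_pow₀ (by norm_num))
  obtain ⟨k, hk1, hk2⟩ := exists_nat_pow_near h1 (show (1 : ℝ) < 16 by norm_num)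
  have e : ((4 : ℝ) ^ k) ^ 2 = 16 ^ k := by rw [← pow_mul, mul_comm, pow_mul]; norm_num
  have h2 := hlow k y (by rw [e]; exact hk1) (by rw [e]; rw [pow_succ] at hk2; linarith)
  have h3 := le_hasSum (hev y) k fun j _ => hnn' y j
  have h4 : (k : ℝ) < 2 ^ k := by exact_mod_cast Nat.lt_two_pow_self
  have h5 : (2 : ℝ) ^ k * (1 / 2) ≤ 2 ^ k * rf.toFn x0 (G k) y := by gcongr
  have h6 : (k : ℝ) < n := by linarith
  have h7 : k ≤ n := by exact_mod_cast h6.le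
  exact hk2.trans_le (pow_le_pow_right₀ (by norm_num) (by omega))

/-- one-sided cutoff -/
noncomputable def cut (H u : X → ℝ) (a : ℝ) : X → ℝ :=
  fun x => max 0 (min a (((fun x => max 0 (min a (u x))) + (-a⁻¹) • H) x))

lemma cut_spec {H u : X → ℝ} (hH : H ∈ rf.F) (hu : u ∈ rf.F) {a : ℝ} (ha : 1 ≤ a) :
    cut H u a ∈ rf.F ∧ rf.E (cut H u a) (cut H u a) ≤ 2 * rf.E u u + 2 * rf.E H H := by
  have ha0 : 0 < a := by linarith
  obtain ⟨h1, h2⟩ := rf.trunc ha0 hu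
  obtain ⟨h3, h4⟩ := rf.trunc ha0 (rf.add_mem h1 (rf.smul_mem (-a⁻¹) hH))
  refine ⟨h3, h4.trans ?_⟩
  have h5 := rf.E_add_le h1 hH (-a⁻¹)
  have h6 : (-a⁻¹) ^ 2 ≤ 1 := by
    rw [neg_sq]
    exact pow_le_one₀ (by positivity) (inv_le_one_of_one_le₀ ha)
  have h7 := mul_le_mul_of_nonneg_right h6 (rf.nonneg H hH)
  linarith

lemma cut_ne {H u : X → ℝ} (hH : ∀ y, 0 ≤ H y) {a : ℝ} (ha : 0 < a) {x : X}
    (hx : cut H u a x ≠ 0) : 0 < u x ∧ H x ≤ a ^ 2 := by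
  have h0 : 0 ≤ a⁻¹ * H x := mul_nonneg (by positivity) (hH x)
  have h1 : 0 < max 0 (min a (u x)) - a⁻¹ * H x := by
    by_contra hcon
    apply hx
    simp only [cut, Pi.add_apply, Pi.smul_apply, smul_eq_mul]
    apply max_eq_left
    apply min_le_of_right_le
    linarith
  constructor
  · by_contra hcon
    have : max 0 (min a (u x)) = 0 := max_eq_left (min_le_of_right_le (not_lt.1 hcon))
    linarith
  · have h2 : max 0 (min a (u x)) ≤ a := max_le ha.le (min_le_left _ _)
    have h3 : a⁻¹ * H x ≤ a := by linarith
    rw [inv_mul_le_iff₀ ha] at h3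
    linarith

lemma cut_tendsto (H u : X → ℝ) (hH : ∀ y, 0 ≤ H y) (x : X) :
    Tendsto (fun n : ℕ => cut H u ((n : ℝ) + 1) x) atTop (𝓝 (max 0 (u x))) := by
  have h1 : Tendsto (fun n : ℕ => max 0 (max 0 (u x) - (1 / ((n : ℝ) + 1)) * H x)) atTop
      (𝓝 (max 0 (max 0 (u x) - 0 * H x))) :=
    tendsto_const_nhds.max (tendsto_const_nhds.sub
      (tendsto_one_div_add_atTop_nhds_zero_nat.mul_const _))
  have e : max 0 (max 0 (u x) - 0 * H x) = max 0 (u x) := by simp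
  rw [e] at h1
  refine h1.congr' ?_
  obtain ⟨N, hN⟩ := exists_nat_ge |u x|
  filter_upwards [eventually_ge_atTop N] with n hn
  have hn' : (N : ℝ) ≤ n := by exact_mod_cast hn
  have h2 : u x ≤ (n : ℝ) + 1 := by have := le_abs_self (u x); linarith
  have h0 : 0 ≤ ((n : ℝ) + 1)⁻¹ * H x := mul_nonneg (by positivity) (hH x)
  have h3 : max 0 (u x) ≤ (n : ℝ) + 1 := max_le (by positivity) h2
  simp only [cut, Pi.add_apply, Pi.smul_apply, smul_eq_mul, min_eq_right h2]
  rw [min_eq_right (by linarith), one_div]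
  congr 1
  ring

/-- Every `u ∈ F` is a weak limit of compactly supported functions supported in `supp u`. -/
lemma exists_approx [CompleteSpace X] (hR : ∀ x y : X, dist x y = rf.rmetric x y)
    (hdb : DoublingOf fun x y : X => dist x y) (x0 : X) {u : X → ℝ} (hu : u ∈ rf.F) :
    ∃ p : ℕ → X → ℝ, (∀ n, p n ∈ rf.F) ∧ (∀ n, IsCompact (tsupport (p n))) ∧
      (∀ n, tsupport (p n) ⊆ tsupport u) ∧
      ∀ v ∈ rf.F, Tendsto (fun n => rf.E (p n) v) atTop (𝓝 (rf.E u v)) := by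
  obtain ⟨H, hH, hnn, hbd⟩ := rf.exists_exhaustion hR hdb x0
  have hneg : (-1 : ℝ) • u ∈ rf.F := rf.smul_mem _ hu
  have hEneg : rf.E ((-1 : ℝ) • u) ((-1 : ℝ) • u) = rf.E u u := by
    rw [rf.smul_left _ _ hu _ hneg, rf.smul_right' _ hu hu]; ring
  have ha : ∀ n : ℕ, (1 : ℝ) ≤ (n : ℝ) + 1 := fun n => by
    have : (0 : ℝ) ≤ n := n.cast_nonneg
    linarith
  have hc1 := fun n : ℕ => rf.cut_spec hH hu (ha n)
  have hc2 := fun n : ℕ => rf.cut_spec hH hneg (ha n)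
  let p : ℕ → X → ℝ := fun n =>
    cut H u ((n : ℝ) + 1) + (-1 : ℝ) • cut H ((-1 : ℝ) • u) ((n : ℝ) + 1)
  have hp : ∀ n, p n ∈ rf.F := fun n => rf.add_mem (hc1 n).1 (rf.smul_mem _ (hc2 n).1)
  have hne : ∀ n x, p n x ≠ 0 → u x ≠ 0 ∧ H x ≤ ((n : ℝ) + 1) ^ 2 := by
    intro n x hx
    have hpos : (0 : ℝ) < (n : ℝ) + 1 := by positivity
    by_cases h1 : cut H u ((n : ℝ) + 1) x = 0
    · have h2 : cut H ((-1 : ℝ) • u) ((n : ℝ) + 1) x ≠ 0 := by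
        intro h2
        apply hx
        simp only [p, Pi.add_apply, Pi.smul_apply, h1, h2]
        simp
      obtain ⟨h3, h4⟩ := cut_ne hnn hpos h2
      refine ⟨?_, h4⟩
      intro h; simp [h] at h3
    · obtain ⟨h3, h4⟩ := cut_ne hnn hpos h1
      exact ⟨h3.ne', h4⟩
  refine ⟨p, hp, ?_, ?_, ?_⟩
  · intro n
    obtain ⟨ρ, hρ⟩ := hbd (((n : ℝ) + 1) ^ 2)
    refine compact_of_bdd hdb (isClosed_tsupport _) x0 (ρ + 1) fun y hy => ?_
    obtain ⟨z, hz, hyz⟩ := Metric.mem_closure_iff.1 hy 1 one_pos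
    have h1 := hρ z (hne n z hz).2
    have h2 := dist_triangle x0 z y
    rw [dist_comm z y] at h2
    linarith
  · intro n
    exact closure_mono fun x hx => (hne n x hx).1
  · intro v hv
    refine rf.weak hR x0 p hp (2 * (2 * rf.E u u + 2 * rf.E H H) +
      2 * (2 * rf.E u u + 2 * rf.E H H)) ?_ hu hv ?_
    · intro n
      have h1 := rf.E_add_le (hc1 n).1 (hc2 n).1 (-1)
      have h2 := (hc1 n).2
      have h3 := (hc2 n).2
      rw [hEneg] at h3
      simp only [p]
      linarith
    · intro x
      have h := (cut_tendsto H u hnn x).sub (cut_tendsto H ((-1 : ℝ) • u) hnn x)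
      have e : max 0 (u x) - max 0 (((-1 : ℝ) • u) x) = u x := by
        simp only [Pi.smul_apply, smul_eq_mul, neg_mul, one_mul]
        rcases le_total 0 (u x) with h | h
        · rw [max_eq_right h, max_eq_left (by linarith)]; ring
        · rw [max_eq_left h, max_eq_right (by linarith)]; ring
      rw [e] at h
      simpa [p, sub_eq_add_neg] using h

end ResistanceForm

/-- Under the standing assumptions (resistance metric complete, doubling
and uniformly perfect), the following locality conditions are equivalent:
(i) `E(u,v) = 0` whenever `supp u ∩ supp v = ∅`;
(ii) `E(u,v) = 0` whenever `inf {R(x,y) : u x ≠ 0, v y ≠ 0} > 0`;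
(iii) `E(u,v) = 0` whenever `u, v` have disjoint compact supports. -/
theorem local_properties_equivalent {X : Type*} [MetricSpace X] [CompleteSpace X]
    (rf : ResistanceForm X) (hR : ∀ x y : X, dist x y = rf.rmetric x y)
    (hdb : DoublingOf fun x y : X => dist x y)
    (hup : UniformlyPerfectOf fun x y : X => dist x y) :
    ((∀ u ∈ rf.F, ∀ v ∈ rf.F, tsupport u ∩ tsupport v = ∅ → rf.E u v = 0) ↔
      (∀ u ∈ rf.F, ∀ v ∈ rf.F,
        (∃ δ : ℝ, 0 < δ ∧ ∀ x y : X, u x ≠ 0 → v y ≠ 0 → δ ≤ dist x y) →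
        rf.E u v = 0)) ∧
    ((∀ u ∈ rf.F, ∀ v ∈ rf.F,
        (∃ δ : ℝ, 0 < δ ∧ ∀ x y : X, u x ≠ 0 → v y ≠ 0 → δ ≤ dist x y) →
        rf.E u v = 0) ↔
      (∀ u ∈ rf.F, ∀ v ∈ rf.F, IsCompact (tsupport u) → IsCompact (tsupport v) →
        tsupport u ∩ tsupport v = ∅ → rf.E u v = 0)) := by
  have h12 : (∀ u ∈ rf.F, ∀ v ∈ rf.F, tsupport u ∩ tsupport v = ∅ → rf.E u v = 0) →
      (∀ u ∈ rf.F, ∀ v ∈ rf.F,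
        (∃ δ : ℝ, 0 < δ ∧ ∀ x y : X, u x ≠ 0 → v y ≠ 0 → δ ≤ dist x y) →
        rf.E u v = 0) := by
    rintro h u hu v hv ⟨δ, hδ, hd⟩
    apply h u hu v hv
    rw [Set.eq_empty_iff_forall_notMem]
    rintro x ⟨hxu, hxv⟩
    obtain ⟨a, ha, hxa⟩ := Metric.mem_closure_iff.1 hxu (δ / 2) (by positivity)
    obtain ⟨b, hb, hxb⟩ := Metric.mem_closure_iff.1 hxv (δ / 2) (by positivity)
    have h1 := hd a b ha hb
    have h2 := dist_triangle a x b
    rw [dist_comm a x] at h2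
    linarith
  have h23 : (∀ u ∈ rf.F, ∀ v ∈ rf.F,
        (∃ δ : ℝ, 0 < δ ∧ ∀ x y : X, u x ≠ 0 → v y ≠ 0 → δ ≤ dist x y) →
        rf.E u v = 0) →
      (∀ u ∈ rf.F, ∀ v ∈ rf.F, IsCompact (tsupport u) → IsCompact (tsupport v) →
        tsupport u ∩ tsupport v = ∅ → rf.E u v = 0) := by
    intro h u hu v hv hcu hcv hdis
    apply h u hu v hv
    obtain ⟨r, hr, hr'⟩ := Metric.exists_pos_forall_lt_edist hcu (isClosed_tsupport v)
      (Set.disjoint_iff_inter_eq_empty.2 hdis)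
    refine ⟨r, hr, fun x y hx hy => ?_⟩
    have h1 := hr' x (subset_tsupport u hx) y (subset_tsupport v hy)
    rw [edist_nndist, ENNReal.coe_lt_coe] at h1
    exact_mod_cast h1.le
  have h31 : (∀ u ∈ rf.F, ∀ v ∈ rf.F, IsCompact (tsupport u) → IsCompact (tsupport v) →
        tsupport u ∩ tsupport v = ∅ → rf.E u v = 0) →
      (∀ u ∈ rf.F, ∀ v ∈ rf.F, tsupport u ∩ tsupport v = ∅ → rf.E u v = 0) := by
    intro h u hu v hv hdis
    rcases isEmpty_or_nonempty X with hX | ⟨⟨x0⟩⟩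
    · exact h u hu v hv (Set.toFinite _).isCompact (Set.toFinite _).isCompact hdis
    obtain ⟨p, hp, hpc, hps, hpl⟩ := rf.exists_approx hR hdb x0 hu
    obtain ⟨q, hq, hqc, hqs, hql⟩ := rf.exists_approx hR hdb x0 hv
    have hpq : ∀ n m, rf.E (q m) (p n) = 0 := by
      intro n m
      rw [rf.symm _ (hq m) _ (hp n)]
      apply h _ (hp n) _ (hq m) (hpc n) (hqc m)
      rw [← Set.subset_empty_iff, ← hdis]
      exact Set.inter_subset_inter (hps n) (hqs m)
    have hpv : ∀ n, rf.E (p n) v = 0 := by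
      intro n
      rw [rf.symm _ (hp n) _ hv]
      have := hql (p n) (hp n)
      simp only [hpq] at this
      exact (tendsto_nhds_unique this tendsto_const_nhds)
    have := hpl v hv
    simp only [hpv] at this
    exact (tendsto_nhds_unique this tendsto_const_nhds)
  exact ⟨⟨h12, fun h => h31 (h23 h)⟩, ⟨h23, fun h => h12 (h31 h)⟩⟩
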